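/- Theorem: Let P be a rook placement on a rectangular Ferrers board F. Then ins(pivL(P)) = ⁻(ins(P)), where ⁻Y denotes the standard Young tableau Y with its left column removed. -/

import Mathlib

open scoped Classical

/-- A cell (square) of the grid: `(column, row)`, both `≥ 1` for genuine cells. -/
abbrev Cell : Type := ℕ × ℕ

/-- The rectangle `R(a,b)` consisting of all cells `(i,j)` with `1 ≤ i ≤ a`, `1 ≤ j ≤ b`. -/
def Rect (a b : ℕ) : Finset Cell := Finset.Icc 1 a ×ˢ Finset.Icc 1 b

/-- A Ferrers board (French notation): a down-left closed finite set of cells with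
positive coordinates. -/
def IsFerrers (F : Finset Cell) : Prop :=
  ∀ p ∈ F, 1 ≤ p.1 ∧ 1 ≤ p.2 ∧
    ∀ q : Cell, 1 ≤ q.1 → 1 ≤ q.2 → q.1 ≤ p.1 → q.2 ≤ p.2 → q ∈ F

/-- A rook placement on a board `F`: a subset of `F` with at most one cell in each
column and at most one cell in each row. -/
def IsPlacement (F P : Finset Cell) : Prop :=
  P ⊆ F ∧ (∀ p ∈ P, ∀ q ∈ P, p.1 = q.1 → p = q) ∧
    (∀ p ∈ P, ∀ q ∈ P, p.2 = q.2 → p = q)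

/-- A decreasing sequence in `P`: columns strictly increase, rows strictly decrease. -/
def IsDecSeq (P : Finset Cell) (k : ℕ) (S : Fin k → Cell) : Prop :=
  (∀ i, S i ∈ P) ∧ ∀ i j : Fin k, i < j → (S i).1 < (S j).1 ∧ (S j).2 < (S i).2

/-- An increasing sequence in `P`: columns and rows both strictly increase. -/
def IsIncSeq (P : Finset Cell) (k : ℕ) (S : Fin k → Cell) : Prop :=
  (∀ i, S i ∈ P) ∧ ∀ i j : Fin k, i < j → (S i).1 < (S j).1 ∧ (S i).2 < (S j).2

/-- Lexicographic comparison of two sequences of cells by their rows (values),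
entry by entry from the left. -/
def rowLexLE (k : ℕ) (S T : Fin k → Cell) : Prop :=
  (∀ i, (S i).2 = (T i).2) ∨
    ∃ i : Fin k, (S i).2 < (T i).2 ∧ ∀ j : Fin k, j < i → (S j).2 = (T j).2

/-- The condition for a left pivot in row `r`, column `c`, given the placement `P` and
the set `prev` of pivots already placed (in rows below `r`): the element of `P` in row
`r` has `c` strictly to its left, column `c` contains an element of `P` below row `r`,
and column `c` contains no pivot yet. -/
def pivCondL (P prev : Finset Cell) (r c : ℕ) : Prop :=
  (∃ x ∈ P, x.2 = r ∧ c < x.1) ∧ (∃ y ∈ P, y.1 = c ∧ y.2 < r) ∧ ∀ v ∈ prev, v.1 ≠ c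

/-- The condition for a right pivot in row `r`, column `c`. -/
def pivCondR (P prev : Finset Cell) (r c : ℕ) : Prop :=
  (∃ x ∈ P, x.2 = r ∧ x.1 < c) ∧ (∃ y ∈ P, y.1 = c ∧ y.2 < r) ∧ ∀ v ∈ prev, v.1 ≠ c

/-- The left pivots among rows `1,…,r`, built row by row from the bottom: no pivot in
the bottom row; in row `r ≥ 2`, if an admissible column exists, the pivot goes in the
rightmost one. -/
noncomputable def pivLAux (P : Finset Cell) : ℕ → Finset Cell
  | 0 => ∅
  | r + 1 =>
    let prev := pivLAux P r
    if r = 0 then prev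
    else if ∃ c, pivCondL P prev (r + 1) c then
      insert (sSup {c | pivCondL P prev (r + 1) c}, r + 1) prev
    else prev

/-- The right pivots among rows `1,…,r`: in row `r ≥ 2`, the pivot goes in the leftmost
admissible column. -/
noncomputable def pivRAux (P : Finset Cell) : ℕ → Finset Cell
  | 0 => ∅
  | r + 1 =>
    let prev := pivRAux P r
    if r = 0 then prev
    else if ∃ c, pivCondR P prev (r + 1) c then
      insert (sInf {c | pivCondR P prev (r + 1) c}, r + 1) prev
    else prev

/-- The left pivots `pivL(P)` of a placement `P` on a board with `n` rows. -/
noncomputable def pivL (n : ℕ) (P : Finset Cell) : Finset Cell := pivLAux P n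

/-- The right pivots `pivR(P)` of a placement `P` on a board with `n` rows. -/
noncomputable def pivR (n : ℕ) (P : Finset Cell) : Finset Cell := pivRAux P n

/-- Robinson–Schensted row insertion of a value `v` into one row: returns the new row
and the bumped value (`none` if `v` was appended at the right end). The leftmost entry
strictly larger than `v` is bumped. -/
def rowInsert (v : ℕ) : List ℕ → List ℕ × Option ℕ
  | [] => ([v], none)
  | x :: xs =>
    if v < x then (v :: xs, some x)
    else
      let p := rowInsert v xs
      (x :: p.1, p.2)

/-- Robinson–Schensted insertion of a value into a tableau (a list of rows, top row
first), bumping cascading down the rows. -/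
def tabInsert (v : ℕ) : List (List ℕ) → List (List ℕ)
  | [] => [[v]]
  | row :: rest =>
    match rowInsert v row with
    | (r, none) => r :: rest
    | (r, some b) => r :: tabInsert b rest

/-- The row of the (unique) cell of `P` in column `c`. -/
noncomputable def rowAt (P : Finset Cell) (c : ℕ) : ℕ := sSup {r | (c, r) ∈ P}

/-- The cells of the placement `P`, as (column, row) pairs listed in increasing order
of column: the two-line notation of the corresponding partial permutation. -/
noncomputable def rsSteps (P : Finset Cell) : List (ℕ × ℕ) :=
  ((P.image Prod.fst).sort (· ≤ ·)).map fun c => (c, rowAt P c)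

/-- The index of the (first) row where two tableaux have different lengths. -/
noncomputable def diffRow (T T' : List (List ℕ)) : ℕ :=
  sInf {r | (T.getD r []).length ≠ (T'.getD r []).length}

/-- Append the value `v` at the right end of row `r` of a tableau (creating a new
bottom row when `r` is one past the last row). -/
def placeAt (v : ℕ) : ℕ → List (List ℕ) → List (List ℕ)
  | 0, [] => [[v]]
  | 0, row :: rest => (row ++ [v]) :: rest
  | _ + 1, [] => [[v]]
  | r + 1, row :: rest => row :: placeAt v r rest

/-- The Robinson–Schensted insertion and recording tableaux of the partial permutation
determined by `P`, columns processed in increasing order. -/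
noncomputable def rsPair (P : Finset Cell) : List (List ℕ) × List (List ℕ) :=
  (rsSteps P).foldl
    (fun TR cv =>
      let T' := tabInsert cv.2 TR.1
      (T', placeAt cv.1 (diffRow TR.1 T') TR.2))
    ([], [])

/-- The Robinson–Schensted insertion tableau `ins(P)`. -/
noncomputable def insTab (P : Finset Cell) : List (List ℕ) := (rsPair P).1

/-- The Robinson–Schensted recording tableau `rec(P)`. -/
noncomputable def recTab (P : Finset Cell) : List (List ℕ) := (rsPair P).2

/-- `⁻Y`: the tableau `Y` with its left column removed. -/
def removeLeftCol (T : List (List ℕ)) : List (List ℕ) :=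
  (T.map List.tail).filter fun r => !r.isEmpty

/-- Knuth equivalence of words (for triples of distinct letters). -/
inductive Knuth : List ℕ → List ℕ → Prop
  | refl (u : List ℕ) : Knuth u u
  | symm {u v : List ℕ} : Knuth u v → Knuth v u
  | trans {u v w : List ℕ} : Knuth u v → Knuth v w → Knuth u w
  | swap_after {x y z : ℕ} (a b : List ℕ) : x < y → y < z →
      Knuth (a ++ y :: z :: x :: b) (a ++ y :: x :: z :: b)
  | swap_before {x y z : ℕ} (a b : List ℕ) : x < y → y < z →
      Knuth (a ++ x :: z :: y :: b) (a ++ z :: x :: y :: b)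

namespace Knuth

theorem perm {u v : List ℕ} (h : Knuth u v) : u.Perm v := by
  induction h with
  | refl u => exact .refl u
  | symm _ ih => exact ih.symm
  | trans _ _ ih₁ ih₂ => exact ih₁.trans ih₂
  | swap_after a b _ _ => exact .append_left _ (.cons _ (.swap _ _ _))
  | swap_before a b _ _ => exact .append_left _ (.swap _ _ _)

theorem append_append {u v : List ℕ} (h : Knuth u v) (c d : List ℕ) :
    Knuth (c ++ u ++ d) (c ++ v ++ d) := by
  induction h with
  | refl u => exact .refl _
  | symm _ ih => exact ih.symm
  | trans _ _ ih₁ ih₂ => exact ih₁.trans ih₂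
  | swap_after a b h₁ h₂ => simpa using swap_after (c ++ a) (b ++ d) h₁ h₂
  | swap_before a b h₁ h₂ => simpa using swap_before (c ++ a) (b ++ d) h₁ h₂

theorem append_left {u v : List ℕ} (h : Knuth u v) (c : List ℕ) : Knuth (c ++ u) (c ++ v) := by
  simpa using h.append_append c []

theorem append_right {u v : List ℕ} (h : Knuth u v) (d : List ℕ) : Knuth (u ++ d) (v ++ d) := by
  simpa using h.append_append [] d

theorem cons {u v : List ℕ} (h : Knuth u v) (c : ℕ) : Knuth (c :: u) (c :: v) :=
  h.append_left [c]

theorem reverse {u v : List ℕ} (h : Knuth u v) : Knuth u.reverse v.reverse := by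
  induction h with
  | refl u => exact .refl _
  | symm _ ih => exact ih.symm
  | trans _ _ ih₁ ih₂ => exact ih₁.trans ih₂
  | swap_after a b h₁ h₂ => simpa using swap_before b.reverse a.reverse h₁ h₂
  | swap_before a b h₁ h₂ => simpa using swap_after b.reverse a.reverse h₁ h₂

end Knuth

theorem rowInsert_of_lt {v x : ℕ} (h : v < x) (l : List ℕ) :
    rowInsert v (x :: l) = (v :: l, some x) := by
  simp [rowInsert, h]

theorem rowInsert_of_le {v x : ℕ} (h : x ≤ v) (l : List ℕ) :
    rowInsert v (x :: l) = (x :: (rowInsert v l).1, (rowInsert v l).2) := by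
  simp [rowInsert, h]

theorem rowInsert_append {v : ℕ} {l : List ℕ} (h : ∀ a ∈ l, a ≤ v) (t : List ℕ) :
    rowInsert v (l ++ t) = (l ++ (rowInsert v t).1, (rowInsert v t).2) := by
  induction l with
  | nil => rfl
  | cons x l ih =>
    rw [List.cons_append, rowInsert_of_le (h x (by simp)), ih fun a ha => h a (by simp [ha])]
    rfl

theorem rowInsert_cases (v : ℕ) (r : List ℕ) :
    ((∀ a ∈ r, a ≤ v) ∧ rowInsert v r = (r ++ [v], none)) ∨
      ∃ l b t, r = l ++ b :: t ∧ (∀ a ∈ l, a ≤ v) ∧ v < b ∧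
        rowInsert v r = (l ++ v :: t, some b) := by
  induction r with
  | nil => exact .inl ⟨by simp, rfl⟩
  | cons x r ih =>
    by_cases hx : v < x
    · exact .inr ⟨[], x, r, rfl, by simp, hx, rowInsert_of_lt hx r⟩
    · rw [rowInsert_of_le (not_lt.1 hx)]
      rcases ih with ⟨h, e⟩ | ⟨l, b, t, rfl, hl, hb, e⟩
      · exact .inl ⟨by simpa [not_lt.1 hx] using h, by simp [e]⟩
      · exact .inr ⟨x :: l, b, t, rfl, by simpa [not_lt.1 hx] using hl, hb, by simp [e]⟩

theorem rowInsert_perm (v : ℕ) (r : List ℕ) :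
    ((rowInsert v r).2.toList ++ (rowInsert v r).1).Perm (v :: r) := by
  rcases rowInsert_cases v r with ⟨_, e⟩ | ⟨l, b, t, rfl, _, _, e⟩
  · simp [e]
  · rw [e]
    simp only [Option.toList_some, List.singleton_append]
    exact ((List.perm_middle.cons b).trans (.swap _ _ _)).trans (List.perm_middle.symm.cons v)

theorem rowInsert_sorted {v : ℕ} {r : List ℕ} (hr : r.Pairwise (· < ·)) (hv : v ∉ r) :
    (rowInsert v r).1.Pairwise (· < ·) := by
  rcases rowInsert_cases v r with ⟨h, e⟩ | ⟨l, b, t, rfl, hl, hb, e⟩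
  · rw [e, List.pairwise_append]
    refine ⟨hr, by simp, fun a ha c hc => ?_⟩
    simp only [List.mem_singleton] at hc
    subst hc
    exact lt_of_le_of_ne (h a ha) fun h => hv (h ▸ ha)
  · rw [e]
    simp only [List.pairwise_append, List.pairwise_cons, List.mem_cons, List.mem_append] at hr hv ⊢
    grind

/-- Row insertion of the letters of a word, from right to left, into a single row `C`: the final
row, and the word of bumped letters. -/
def bump (C : List ℕ) : List ℕ → List ℕ × List ℕ
  | [] => (C, [])
  | v :: u => ((rowInsert v (bump C u).1).1,
      (rowInsert v (bump C u).1).2.toList ++ (bump C u).2)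

theorem bump_append (C a b : List ℕ) :
    bump C (a ++ b) = ((bump (bump C b).1 a).1, (bump (bump C b).1 a).2 ++ (bump C b).2) := by
  induction a with
  | nil => simp [bump]
  | cons x a ih => simp [bump, ih]

theorem bump_perm (C u : List ℕ) : ((bump C u).2 ++ (bump C u).1).Perm (u ++ C) := by
  induction u with
  | nil => simp [bump]
  | cons v u ih =>
    simp only [bump]
    have h := rowInsert_perm v (bump C u).1
    refine (List.perm_append_comm.append_right _).trans ?_
    rw [List.append_assoc]
    exact ((h.append_left _).trans List.perm_middle).trans (ih.cons v)

theorem bump_sorted {C u : List ℕ} (hC : C.Pairwise (· < ·)) (h : (u ++ C).Nodup) :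
    (bump C u).1.Pairwise (· < ·) := by
  induction u with
  | nil => simpa [bump]
  | cons v u ih =>
    rw [List.cons_append, List.nodup_cons] at h
    refine rowInsert_sorted (ih h.2) fun hv => h.1 ?_
    exact (bump_perm C u).subset (by simp [hv])

theorem bump_swap_after {x y z : ℕ} (hxy : x < y) (hyz : y < z) {C : List ℕ}
    (hC : C.Pairwise (· < ·)) (hx : x ∉ C) (hz : z ∉ C) :
    (bump C [y, z, x]).1 = (bump C [y, x, z]).1 ∧
      Knuth (bump C [y, z, x]).2 (bump C [y, x, z]).2 := by
  induction C with
  | nil =>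
    have h₁ : ¬ z < x := by omega
    have h₂ : ¬ y < x := by omega
    have h₃ : x < z := by omega
    simp [bump, rowInsert, h₁, h₂, h₃, hyz, Knuth.refl]
  | cons c C ih =>
    simp only [List.mem_cons, not_or, List.pairwise_cons] at hx hz hC
    rcases lt_or_gt_of_ne hx.1 with hxc | hxc
    · rcases lt_or_gt_of_ne hz.1 with hzc | hzc
      · have h₁ : x < z := by omega
        simp only [bump, rowInsert_of_lt hxc, rowInsert_of_lt hzc, rowInsert_of_lt h₁,
          rowInsert_of_le h₁.le, rowInsert_of_le hxy.le]
        rcases C with _ | ⟨d, C⟩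
        · simp [rowInsert, hyz, Knuth.refl]
        · have hd : c < d := hC.1 d (by simp)
          simp only [rowInsert_of_lt (hzc.trans hd), rowInsert_of_lt hyz,
            rowInsert_of_lt (hyz.trans (hzc.trans hd))]
          exact ⟨trivial, .swap_before [] [] hzc hd⟩
      · have h₁ : x < z := by omega
        simp only [bump, rowInsert_of_lt hxc, rowInsert_of_le hzc.le, rowInsert_of_le hxy.le,
          rowInsert_of_le h₁.le]
        refine ⟨trivial, ?_⟩
        rcases rowInsert_cases z C with ⟨_, e⟩ | ⟨l, b, t, rfl, hl, hb, e⟩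
        · simp [e, Knuth.refl]
        · simp only [e]
          rcases rowInsert_cases y (l ++ z :: t) with ⟨h, _⟩ | ⟨l', e', t', h', hl', he', h''⟩
          · exact absurd (h z (by simp)) (by omega)
          · simp only [h'', Option.toList_some, List.singleton_append, List.append_nil]
            refine .swap_after [] [] ?_ ?_
            · have : e' ∈ l ++ z :: t := by simp [h']
              simp only [List.mem_append, List.mem_cons] at this
              rcases this with h | h | h
              · exact hC.1 _ (by simp [h])
              · omega
              · exact hC.1 _ (by simp [h])
            · have hs : (l ++ z :: t).Pairwise (· < ·) := by
                have := rowInsert_sorted hC.2 hz.2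
                rwa [e] at this
              have hm : z ∈ l' ++ e' :: t' := by simp [← h']
              rw [h', List.pairwise_append, List.pairwise_cons] at hs
              simp only [List.mem_append, List.mem_cons] at hm
              rcases hm with h | h | h
              · exact absurd (hl' _ h) (by omega)
              · omega
              · have := hs.2.1.1 _ h
                omega
    · have h₁ : c ≤ y := by omega
      have h₂ : c ≤ z := by omega
      simpa [bump, rowInsert_of_le hxc.le, rowInsert_of_le h₁, rowInsert_of_le h₂] using
        ih hC.2 hx.2 hz.2

theorem bump_swap_before {x y z : ℕ} (hxy : x < y) (hyz : y < z) {C : List ℕ}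
    (hC : C.Pairwise (· < ·)) (hx : x ∉ C) (hy : y ∉ C) :
    (bump C [x, z, y]).1 = (bump C [z, x, y]).1 ∧
      Knuth (bump C [x, z, y]).2 (bump C [z, x, y]).2 := by
  induction C with
  | nil =>
    have h₁ : ¬ z < x := by omega
    have h₂ : ¬ z < y := by omega
    simp [bump, rowInsert, h₁, h₂, hxy, Knuth.refl]
  | cons c C ih =>
    simp only [List.mem_cons, not_or, List.pairwise_cons] at hx hy hC
    have hxz : x < z := by omega
    rcases lt_or_gt_of_ne hx.1 with hxc | hxc
    · rcases lt_or_gt_of_ne hy.1 with hyc | hyc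
      · simp only [bump, rowInsert_of_lt hyc, rowInsert_of_lt hxy, rowInsert_of_le hyz.le,
          rowInsert_of_le hxz.le]
        refine ⟨trivial, ?_⟩
        rcases rowInsert_cases z C with ⟨_, e⟩ | ⟨l, b, t, rfl, hl, hb, e⟩
        · simp [e, Knuth.refl]
        · simp only [e]
          exact .swap_before [] [] hyc (hC.1 b (by simp))
      · have hcz : c < z := by omega
        simp only [bump, rowInsert_of_le hyc.le, rowInsert_of_le hcz.le, rowInsert_of_lt hxc,
          rowInsert_of_le hxz.le]
        refine ⟨trivial, ?_⟩
        rcases rowInsert_cases y C with ⟨h, e⟩ | ⟨l, b, t, rfl, hl, hb, e⟩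
        · have h' : ∀ a ∈ C ++ [y], a ≤ z := by
            intro a ha
            simp only [List.mem_append, List.mem_singleton] at ha
            rcases ha with ha | ha
            · have := h a ha
              omega
            · omega
          have h'' := rowInsert_append h' []
          simp only [List.append_nil] at h''
          simp [e, h'', rowInsert, Knuth.refl]
        · have h' : ∀ a ∈ l ++ [y], a ≤ z := by
            intro a ha
            simp only [List.mem_append, List.mem_singleton] at ha
            rcases ha with ha | ha
            · have := hl a ha
              omega
            · omega
          have h'' := rowInsert_append h' t
          simp only [List.append_assoc, List.singleton_append] at h''
          simp only [e, h'']
          rcases rowInsert_cases z t with ⟨_, e'⟩ | ⟨l', b', t', rfl, _, _, e'⟩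
          · simp [e', Knuth.refl]
          · simp only [e']
            have := hC.2
            simp only [List.pairwise_append, List.pairwise_cons] at this
            exact .swap_before [] [] (hC.1 b (by simp)) (this.2.1.1 b' (by simp))
    · have h₁ : c ≤ y := by omega
      have h₂ : c ≤ z := by omega
      simpa [bump, rowInsert_of_le hxc.le, rowInsert_of_le h₁, rowInsert_of_le h₂] using
        ih hC.2 hx.2 hy.2

theorem bump_context {C a b t t' : List ℕ}
    (h : (bump (bump C b).1 t).1 = (bump (bump C b).1 t').1 ∧
      Knuth (bump (bump C b).1 t).2 (bump (bump C b).1 t').2) :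
    (bump C (a ++ (t ++ b))).1 = (bump C (a ++ (t' ++ b))).1 ∧
      Knuth (bump C (a ++ (t ++ b))).2 (bump C (a ++ (t' ++ b))).2 := by
  simp only [bump_append, h.1, true_and]
  exact (h.2.append_right _).append_left _

/-- Knuth equivalent words produce the same row and Knuth equivalent bumped words. -/
theorem Knuth.bump {u v : List ℕ} (h : Knuth u v) (hu : u.Nodup) :
    (bump [] u).1 = (bump [] v).1 ∧ Knuth (bump [] u).2 (bump [] v).2 := by
  induction h with
  | refl u => exact ⟨rfl, .refl _⟩
  | symm h ih =>
    have := ih (h.perm.nodup_iff.2 hu)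
    exact ⟨this.1.symm, this.2.symm⟩
  | trans h₁ h₂ ih₁ ih₂ =>
    have h₃ := ih₁ hu
    have h₄ := ih₂ (h₁.perm.nodup_iff.1 hu)
    exact ⟨h₃.1.trans h₄.1, h₃.2.trans h₄.2⟩
  | @swap_after x y z a b hxy hyz =>
    have hb : ∀ w ∈ (_root_.bump [] b).1, w ∈ b := fun w hw => by
      simpa using (bump_perm [] b).subset (a := w) (by simp [hw])
    simp only [List.nodup_append, List.nodup_cons, List.mem_cons, not_or] at hu
    exact bump_context (t := [y, z, x]) (t' := [y, x, z])
      (bump_swap_after hxy hyz (bump_sorted .nil (by grind)) (by grind) (by grind))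
  | @swap_before x y z a b hxy hyz =>
    have hb : ∀ w ∈ (_root_.bump [] b).1, w ∈ b := fun w hw => by
      simpa using (bump_perm [] b).subset (a := w) (by simp [hw])
    simp only [List.nodup_append, List.nodup_cons, List.mem_cons, not_or] at hu
    exact bump_context (t := [x, z, y]) (t' := [z, x, y])
      (bump_swap_before hxy hyz (bump_sorted .nil (by grind)) (by grind) (by grind))

theorem bump_ne_nil {u : List ℕ} (hu : u ≠ []) : (bump [] u).1 ≠ [] := by
  rcases u with _ | ⟨v, u⟩
  · exact absurd rfl hu
  · simp only [bump]
    rcases rowInsert_cases v (bump [] u).1 with ⟨_, e⟩ | ⟨l, b, t, _, _, _, e⟩ <;> simp [e]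

theorem bump_snd_length_lt {u : List ℕ} (hu : u ≠ []) : (bump [] u).2.length < u.length := by
  have h := (bump_perm [] u).length_eq
  have h' := List.length_pos_iff.2 (bump_ne_nil hu)
  simp only [List.length_append, List.length_nil] at h
  omega

theorem tabInsert_cons (v : ℕ) (r : List ℕ) (T : List (List ℕ)) :
    tabInsert v (r :: T) = (rowInsert v r).1 :: (rowInsert v r).2.toList.foldr tabInsert T := by
  rcases rowInsert_cases v r with ⟨_, e⟩ | ⟨l, b, t, _, _, _, e⟩ <;> simp [tabInsert, e]

theorem foldr_tabInsert {u : List ℕ} (hu : u ≠ []) :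
    u.foldr tabInsert [] = (bump [] u).1 :: (bump [] u).2.foldr tabInsert [] := by
  induction u with
  | nil => exact absurd rfl hu
  | cons v u ih =>
    rcases eq_or_ne u [] with rfl | hu'
    · simp [bump, rowInsert, tabInsert]
    · rw [List.foldr_cons, ih hu', tabInsert_cons, bump, List.foldr_append]

/-- Knuth equivalent words have the same insertion tableau. -/
theorem Knuth.foldr_tabInsert_eq {u v : List ℕ} (h : Knuth u v) (hu : u.Nodup) :
    u.foldr tabInsert [] = v.foldr tabInsert [] := by
  induction hn : u.length using Nat.strong_induction_on generalizing u v with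
  | _ n ih =>
    rcases eq_or_ne u [] with rfl | hu'
    · rw [h.perm.nil_eq]
    · have hv : v ≠ [] := fun hv => hu' (h.perm.trans (by rw [hv])).eq_nil
      have hb := h.bump hu
      have hn' := ((bump_perm [] u).nodup_iff.2 (by simpa using hu)).of_append_left
      rw [foldr_tabInsert hu', foldr_tabInsert hv, hb.1,
        ih _ (hn ▸ bump_snd_length_lt hu') hb.2 hn' rfl]

/-- The row reading word of a tableau: rows are read from left to right, bottom row first. -/
def rowReading : List (List ℕ) → List ℕ
  | [] => []
  | r :: T => rowReading T ++ r

/-- The row `s` fits below the row `r` in a tableau: it is at most as long as `r`, and each of its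
entries is larger than the entry of `r` in the same position. -/
inductive Below : List ℕ → List ℕ → Prop
  | nil (r : List ℕ) : Below r []
  | cons {a b : ℕ} {r s : List ℕ} : a < b → Below r s → Below (a :: r) (b :: s)

namespace Below

theorem append {r s : List ℕ} (h : Below r s) (l : List ℕ) : Below (r ++ l) s := by
  induction h with
  | nil r => exact .nil _
  | cons hab _ ih => exact .cons hab ih

theorem tail {r s : List ℕ} (h : Below r s) : Below r.tail s.tail := by
  cases h with
  | nil r => exact .nil _
  | cons _ h => exact h

theorem replace {l t s : List ℕ} {b v : ℕ} (hv : v < b) (h : Below (l ++ b :: t) s) :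
    Below (l ++ v :: t) s := by
  induction l generalizing s with
  | nil =>
    cases h with
    | nil => exact .nil _
    | cons hab h => exact .cons (hv.trans hab) h
  | cons c l ih =>
    cases h with
    | nil => exact .nil _
    | cons hab h => exact .cons hab (ih h)

theorem rowInsert {l t s : List ℕ} {b v : ℕ} (hv : v < b)
    (hr : (l ++ b :: t).Pairwise (· < ·)) (h : Below (l ++ b :: t) s) :
    Below (l ++ v :: t) (rowInsert b s).1 := by
  induction l generalizing s with
  | nil =>
    cases h with
    | nil => exact .cons hv (.nil _)
    | cons hab h =>
      rw [rowInsert_of_lt hab]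
      exact .cons hv h
  | cons c l ih =>
    simp only [List.cons_append, List.pairwise_cons] at hr
    have hcb : c < b := hr.1 b (by simp)
    cases h with
    | nil => exact .cons hcb (.nil _)
    | @cons _ d _ s hcd h =>
      rcases lt_or_ge b d with hbd | hbd
      · rw [rowInsert_of_lt hbd]
        exact .cons hcb (h.replace hv)
      · rw [rowInsert_of_le hbd]
        exact .cons hcd (ih hr.2 h)

end Below

/-- Partial standard Young tableaux, as lists of rows. -/
def IsTableau : List (List ℕ) → Prop
  | [] => True
  | r :: T => r ≠ [] ∧ r.Pairwise (· < ·) ∧ Below r (T.headD []) ∧ IsTableau T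

theorem headD_tabInsert (v : ℕ) (T : List (List ℕ)) :
    (tabInsert v T).headD [] = (rowInsert v (T.headD [])).1 := by
  rcases T with _ | ⟨r, T⟩
  · rfl
  · rw [tabInsert_cons]
    rfl

theorem Knuth.append_singleton_cons {y x : ℕ} {l : List ℕ} (hl : (x :: l).Pairwise (· < ·))
    (hy : y < x) : Knuth (x :: l ++ [y]) (x :: y :: l) := by
  induction l generalizing x with
  | nil => exact .refl _
  | cons z l ih =>
    rw [List.pairwise_cons] at hl
    have hxz : x < z := hl.1 z (by simp)
    exact ((ih hl.2 (hy.trans hxz)).cons x).trans (.swap_after [] l hy hxz)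

theorem Knuth.append_singleton {y b : ℕ} {l t : List ℕ} (hr : (l ++ b :: t).Pairwise (· < ·))
    (hl : ∀ a ∈ l, a < y) (hb : y < b) : Knuth (l ++ b :: t ++ [y]) (b :: (l ++ y :: t)) := by
  induction l with
  | nil => exact append_singleton_cons hr hb
  | cons x l ih =>
    have hx : x < y := hl x (by simp)
    simp only [List.cons_append, List.pairwise_cons] at hr
    refine ((ih hr.2 fun a ha => hl a (by simp [ha])).cons x).trans ?_
    rcases l with _ | ⟨c, l⟩
    · exact .swap_before [] t hx hb
    · have hcy : c < y := hl c (by simp)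
      exact .swap_before [] (l ++ y :: t) (hr.1 c (by simp)) (hcy.trans hb)

theorem tabInsert_spec {T : List (List ℕ)} {v : ℕ} (hT : IsTableau T)
    (hv : (rowReading T ++ [v]).Nodup) :
    IsTableau (tabInsert v T) ∧ Knuth (rowReading T ++ [v]) (rowReading (tabInsert v T)) := by
  induction T generalizing v with
  | nil => simp [tabInsert, IsTableau, rowReading, Knuth.refl, Below.nil]
  | cons r T ih =>
    obtain ⟨h₁, h₂, h₃, h₄⟩ := hT
    have hvr : v ∉ r := by
      simp only [rowReading, List.nodup_append] at hv
      grind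
    rcases rowInsert_cases v r with ⟨h, e⟩ | ⟨l, b, t, rfl, hl, hb, e⟩
    · simp only [tabInsert, e]
      have h₅ := rowInsert_sorted h₂ hvr
      rw [e] at h₅
      refine ⟨⟨by simp, h₅, h₃.append _, h₄⟩, ?_⟩
      simp [rowReading, Knuth.refl]
    · simp only [tabInsert, e]
      have h₅ := rowInsert_sorted h₂ hvr
      rw [e] at h₅
      have h₆ := ih (v := b) h₄ (by
        simp only [rowReading, List.nodup_append] at hv ⊢
        grind)
      refine ⟨⟨by simp, h₅, ?_, h₆.1⟩, ?_⟩
      · rw [headD_tabInsert]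
        exact h₃.rowInsert hb h₂
      · have hl' : ∀ a ∈ l, a < v := fun a ha =>
          lt_of_le_of_ne (hl a ha) fun h => hvr (by simp [← h, ha])
        have h₇ := (Knuth.append_singleton h₂ hl' hb).append_left (rowReading T)
        have h₈ := h₆.2.append_right (l ++ v :: t)
        simp only [rowReading, List.append_assoc, List.singleton_append] at h₇ h₈ ⊢
        exact h₇.trans h₈

theorem foldr_tabInsert_spec {u : List ℕ} (hu : u.Nodup) :
    IsTableau (u.foldr tabInsert []) ∧
      Knuth u.reverse (rowReading (u.foldr tabInsert [])) := by
  induction u with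
  | nil => exact ⟨trivial, .refl _⟩
  | cons v u ih =>
    have h := ih hu.of_cons
    have h' := h.2.append_right [v]
    rw [← List.reverse_cons] at h'
    have h'' := tabInsert_spec h.1 (h'.perm.nodup_iff.1 (List.nodup_reverse.2 hu))
    exact ⟨h''.1, h'.trans h''.2⟩

theorem bump_row {C r : List ℕ} {a : ℕ} (hr : (a :: r).Pairwise (· < ·))
    (hC : ∀ c ∈ C, c < a) : bump C (a :: r) = (C ++ [a], r) := by
  induction r generalizing a with
  | nil =>
    have := rowInsert_append (v := a) (fun c hc => (hC c hc).le) []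
    simp only [List.append_nil] at this
    simp [bump, this, rowInsert]
  | cons b r ih =>
    rw [List.pairwise_cons] at hr
    have hab : a < b := hr.1 b (by simp)
    rw [bump, ih hr.2 fun c hc => (hC c hc).trans hab]
    simp [rowInsert_append fun c hc => (hC c hc).le, rowInsert_of_lt hab]

theorem bump_rowReading {C : List ℕ} {T : List (List ℕ)} (hT : IsTableau T)
    (hC : ∀ c ∈ C, ∀ a ∈ (T.headD []).head?, c < a) :
    (bump C (rowReading T)).2 = rowReading (T.map List.tail) := by
  induction T generalizing C with
  | nil => rfl
  | cons r T ih =>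
    obtain ⟨h₁, h₂, h₃, h₄⟩ := hT
    rcases r with _ | ⟨a, r⟩
    · exact absurd rfl h₁
    have hC' : ∀ c ∈ C, c < a := by simpa using hC
    simp only [rowReading, bump_append, bump_row h₂ hC', List.map_cons, List.tail_cons]
    rw [ih h₄]
    intro c hc b hb
    generalize T.headD [] = s at h₃ hb
    cases s with
    | nil => simp at hb
    | cons d s =>
      simp only [List.head?_cons, Option.mem_def, Option.some.injEq] at hb
      subst hb
      cases h₃ with
      | cons hab _ =>
        simp only [List.mem_append, List.mem_singleton] at hc
        rcases hc with hc | rfl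
        · exact (hC' c hc).trans hab
        · exact hab

theorem rowReading_removeLeftCol (T : List (List ℕ)) :
    rowReading (removeLeftCol T) = rowReading (T.map List.tail) := by
  induction T with
  | nil => rfl
  | cons r T ih =>
    rcases h : r.tail with _ | ⟨a, t⟩
    · simpa [removeLeftCol, rowReading, h] using ih
    · simpa [removeLeftCol, rowReading, h] using ih

theorem removeLeftCol_isTableau {T : List (List ℕ)} (hT : IsTableau T) :
    IsTableau (removeLeftCol T) ∧ (removeLeftCol T).headD [] = (T.headD []).tail := by
  induction T with
  | nil => exact ⟨trivial, rfl⟩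
  | cons r T ih =>
    obtain ⟨h₁, h₂, h₃, h₄⟩ := hT
    obtain ⟨h₅, h₆⟩ := ih h₄
    rcases h : r.tail with _ | ⟨a, t⟩
    · have h₇ : removeLeftCol (r :: T) = removeLeftCol T := by simp [removeLeftCol, h]
      have h₈ := h₃.tail
      rw [h, ← h₆] at h₈
      rw [h₇]
      refine ⟨h₅, ?_⟩
      rw [List.headD_cons, h]
      generalize (removeLeftCol T).headD [] = s at h₈
      cases h₈
      rfl
    · have h₇ : removeLeftCol (r :: T) = r.tail :: removeLeftCol T := by simp [removeLeftCol, h]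
      rw [h₇]
      exact ⟨⟨by simp [h], h₂.tail, h₆ ▸ h₃.tail, h₅⟩, rfl⟩

theorem bump_reverse_of_below {D r s : List ℕ} (h : Below r s) (hr : (D ++ r).Pairwise (· < ·)) :
    bump (D ++ s) r.reverse = (D ++ r, s.reverse) := by
  induction r generalizing D s with
  | nil =>
    cases h
    rfl
  | cons a r ih =>
    have hD : ∀ c ∈ D, c ≤ a := fun c hc =>
      ((List.pairwise_append.1 hr).2.2 c hc a (by simp)).le
    have hr' : (D ++ [a] ++ r).Pairwise (· < ·) := by simpa using hr
    rw [List.reverse_cons, bump_append]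
    cases h with
    | nil =>
      have h' := ih (D := D ++ [a]) (.nil r) hr'
      simp only [List.append_nil, List.append_assoc, List.singleton_append] at h'
      have h'' := rowInsert_append hD []
      simp only [List.append_nil] at h''
      simp [bump, h'', rowInsert, h']
    | cons hab h =>
      have h' := ih (D := D ++ [a]) h hr'
      simp only [List.append_assoc, List.singleton_append] at h'
      simp [bump, rowInsert_append hD, rowInsert_of_lt hab, h']

theorem bump_reverse_rowReading {T : List (List ℕ)} (hT : IsTableau T) :
    bump [] (rowReading T).reverse = (T.headD [], (rowReading T.tail).reverse) := by
  induction T with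
  | nil => rfl
  | cons r T ih =>
    obtain ⟨h₁, h₂, h₃, h₄⟩ := hT
    have h := bump_reverse_of_below (D := []) h₃ h₂
    simp only [List.nil_append] at h
    simp only [rowReading, List.reverse_append, bump_append, ih h₄, h]
    rcases T with _ | ⟨s, T⟩ <;> simp [rowReading]

theorem foldr_tabInsert_reverse_rowReading {T : List (List ℕ)} (hT : IsTableau T) :
    (rowReading T).reverse.foldr tabInsert [] = T := by
  induction T with
  | nil => rfl
  | cons r T ih =>
    rw [foldr_tabInsert (by simp [rowReading, hT.1]), bump_reverse_rowReading hT]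
    simp [ih hT.2.2.2]

/-- Row insertion of the word bumped from the left column removes the left column. -/
theorem foldr_tabInsert_bump {w : List ℕ} (hw : w.Nodup) :
    (bump [] w).2.reverse.foldr tabInsert [] = removeLeftCol (w.reverse.foldr tabInsert []) := by
  obtain ⟨h₁, h₂⟩ := foldr_tabInsert_spec (List.nodup_reverse.2 hw)
  rw [List.reverse_reverse] at h₂
  have h₃ := (h₂.bump hw).2
  rw [bump_rowReading h₁ (by simp), ← rowReading_removeLeftCol] at h₃
  have h₄ : (bump [] w).2.Nodup :=
    ((bump_perm [] w).nodup_iff.2 (by simpa using hw)).of_append_left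
  rw [h₃.reverse.foldr_tabInsert_eq (List.nodup_reverse.2 h₄),
    foldr_tabInsert_reverse_rowReading (removeLeftCol_isTableau h₁).1]

/-- A pivot is allowed in column `c` and row `r`: the cell of `P` in row `r` is to the right of
column `c`, and the cell of `P` in column `c` is below row `r`. -/
def Admissible (P : Set Cell) (c r : ℕ) : Prop :=
  (∃ x ∈ P, x.2 = r ∧ c < x.1) ∧ ∃ y ∈ P, y.1 = c ∧ y.2 < r

/-- A matching of columns and rows by admissible positions that is stable when every column
prefers low rows and every row prefers columns on the right. -/
structure IsStable (P M : Set Cell) : Prop where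
  admissible : ∀ p ∈ M, Admissible P p.1 p.2
  fst_inj : ∀ p ∈ M, ∀ q ∈ M, p.1 = q.1 → p = q
  snd_inj : ∀ p ∈ M, ∀ q ∈ M, p.2 = q.2 → p = q
  stable : ∀ c r, Admissible P c r → (∃ r' ≤ r, (c, r') ∈ M) ∨ ∃ c' ≥ c, (c', r) ∈ M

namespace IsStable

variable {P M N : Set Cell}

theorem exists_right (hM : IsStable P M) (hN : IsStable P N) {c r : ℕ} (h : (c, r) ∈ M)
    (h' : (c, r) ∉ N) : ∃ c' r', c < c' ∧ (c', r') ∈ M ∧ (c', r') ∉ N := by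
  rcases hN.stable c r (hM.admissible _ h) with ⟨r', hr', hn⟩ | ⟨c', hc', hn⟩
  · have hne : r' ≠ r := fun e => h' (e ▸ hn)
    rcases hM.stable c r' (hN.admissible _ hn) with ⟨s, hs, hm⟩ | ⟨d, hd, hm⟩
    · have := hM.fst_inj _ hm _ h rfl
      simp only [Prod.mk.injEq] at this
      omega
    · have hdc : d ≠ c := by
        rintro rfl
        have := hM.fst_inj _ hm _ h rfl
        simp only [Prod.mk.injEq] at this
        omega
      refine ⟨d, r', by omega, hm, fun hn' => hdc ?_⟩
      simpa using hN.snd_inj _ hn' _ hn rfl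
  · have hne : c' ≠ c := fun e => h' (e ▸ hn)
    rcases hM.stable c' r (hN.admissible _ hn) with ⟨s, hs, hm⟩ | ⟨d, hd, hm⟩
    · refine ⟨c', s, by omega, hm, fun hn' => hne ?_⟩
      have hsr : s = r := by simpa using hN.fst_inj _ hn' _ hn rfl
      subst hsr
      simpa using hM.snd_inj _ hm _ h rfl
    · have := hM.snd_inj _ hm _ h rfl
      simp only [Prod.mk.injEq] at this
      omega

theorem subset (hM : IsStable P M) (hN : IsStable P N) {B : ℕ} (hB : ∀ p ∈ P, p.1 ≤ B) :
    M ⊆ N := by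
  rintro ⟨c, r⟩ h
  by_contra h'
  induction hk : B - c using Nat.strong_induction_on generalizing c r with
  | _ k ih =>
    obtain ⟨c', r', hc, hm, hn⟩ := hM.exists_right hN h h'
    obtain ⟨⟨x, hx, -, hcx⟩, -⟩ := hM.admissible _ hm
    have := hB x hx
    simp only at hcx
    exact ih (B - c') (by omega) c' r' hm hn rfl

theorem eq (hM : IsStable P M) (hN : IsStable P N) {B : ℕ} (hB : ∀ p ∈ P, p.1 ≤ B) : M = N :=
  (hM.subset hN hB).antisymm (hN.subset hM hB)

end IsStable

theorem pivLAux_spec {P : Finset Cell} (hP : ∀ p ∈ P, 1 ≤ p.2) (k : ℕ) :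
    (∀ p ∈ pivLAux P k, Admissible P p.1 p.2 ∧ p.2 ≤ k) ∧
    (∀ p ∈ pivLAux P k, ∀ q ∈ pivLAux P k, p.1 = q.1 → p = q) ∧
    (∀ p ∈ pivLAux P k, ∀ q ∈ pivLAux P k, p.2 = q.2 → p = q) ∧
    ∀ c r, r ≤ k → Admissible P c r →
      (∃ r' ≤ r, (c, r') ∈ pivLAux P k) ∨ ∃ c' ≥ c, (c', r) ∈ pivLAux P k := by
  induction k with
  | zero =>
    refine ⟨by simp [pivLAux], by simp [pivLAux], by simp [pivLAux], ?_⟩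
    rintro c r hr ⟨-, y, -, -, hy⟩
    omega
  | succ k ih =>
    obtain ⟨h₁, h₂, h₃, h₄⟩ := ih
    rcases Nat.eq_zero_or_pos k with rfl | hk
    · refine ⟨by simp [pivLAux], by simp [pivLAux], by simp [pivLAux], ?_⟩
      rintro c r hr ⟨-, y, hy, -, hy'⟩
      have := hP y hy
      omega
    by_cases hex : ∃ c, pivCondL P (pivLAux P k) (k + 1) c
    · have hbdd : BddAbove {c | pivCondL P (pivLAux P k) (k + 1) c} := by
        refine ⟨P.sup Prod.fst, ?_⟩
        rintro c ⟨⟨x, hx, -, hcx⟩, -⟩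
        exact hcx.le.trans (Finset.le_sup (f := Prod.fst) hx)
      have hmem : pivCondL P (pivLAux P k) (k + 1)
          (sSup {c | pivCondL P (pivLAux P k) (k + 1) c}) := Nat.sSup_mem hex hbdd
      have hle : ∀ c, pivCondL P (pivLAux P k) (k + 1) c →
          c ≤ sSup {c | pivCondL P (pivLAux P k) (k + 1) c} := fun c hc => le_csSup hbdd hc
      have heq : pivLAux P (k + 1) =
          insert (sSup {c | pivCondL P (pivLAux P k) (k + 1) c}, k + 1) (pivLAux P k) := by
        simp [pivLAux, hk.ne', hex]
      rw [heq]
      generalize sSup {c | pivCondL P (pivLAux P k) (k + 1) c} = d at hmem hle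
      obtain ⟨hx, hy, hd⟩ := hmem
      simp only [Finset.mem_insert]
      refine ⟨?_, ?_, ?_, ?_⟩
      · rintro p (rfl | hp)
        · exact ⟨⟨hx, hy⟩, le_rfl⟩
        · exact ⟨(h₁ p hp).1, (h₁ p hp).2.trans k.le_succ⟩
      · rintro p (rfl | hp) q (rfl | hq) hpq
        · rfl
        · exact absurd hpq.symm (hd q hq)
        · exact absurd hpq (hd p hp)
        · exact h₂ p hp q hq hpq
      · rintro p (rfl | hp) q (rfl | hq) hpq
        · rfl
        · have := (h₁ q hq).2
          simp only at hpq
          omega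
        · have := (h₁ p hp).2
          simp only at hpq
          omega
        · exact h₃ p hp q hq hpq
      · intro c r hr hcr
        rcases Nat.lt_or_ge k r with hkr | hkr
        · obtain rfl : r = k + 1 := by omega
          by_cases hv : ∀ v ∈ pivLAux P k, v.1 ≠ c
          · exact .inr ⟨d, hle c ⟨hcr.1, hcr.2, hv⟩, .inl rfl⟩
          · push Not at hv
            obtain ⟨v, hv, rfl⟩ := hv
            exact .inl ⟨v.2, by have := (h₁ v hv).2; omega, .inr hv⟩
        · rcases h₄ c r hkr hcr with ⟨r', h, h'⟩ | ⟨c', h, h'⟩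
          · exact .inl ⟨r', h, .inr h'⟩
          · exact .inr ⟨c', h, .inr h'⟩
    · have heq : pivLAux P (k + 1) = pivLAux P k := by simp [pivLAux, hex]
      rw [heq]
      refine ⟨fun p hp => ⟨(h₁ p hp).1, (h₁ p hp).2.trans k.le_succ⟩, h₂, h₃, ?_⟩
      intro c r hr hcr
      rcases Nat.lt_or_ge k r with hkr | hkr
      · obtain rfl : r = k + 1 := by omega
        by_cases hv : ∀ v ∈ pivLAux P k, v.1 ≠ c
        · exact absurd ⟨c, hcr.1, hcr.2, hv⟩ hex
        · push Not at hv
          obtain ⟨v, hv, rfl⟩ := hv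
          exact .inl ⟨v.2, by have := (h₁ v hv).2; omega, hv⟩
      · exact h₄ c r hkr hcr

theorem pivL_isStable {n : ℕ} {P : Finset Cell} (hP : ∀ p ∈ P, 1 ≤ p.2 ∧ p.2 ≤ n) :
    IsStable P (pivL n P) := by
  obtain ⟨h₁, h₂, h₃, h₄⟩ := pivLAux_spec (fun p hp => (hP p hp).1) n
  refine ⟨fun p hp => (h₁ p hp).1, h₂, h₃, fun c r hcr => h₄ c r ?_ hcr⟩
  obtain ⟨⟨x, hx, rfl, -⟩, -⟩ := hcr
  exact (hP x hx).2

/-- Column insertion of the cells of a placement, listed by increasing columns, from right to left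
into a single column: the final column, and the bumped rows with the columns that bump them. -/
def bumpCells : List Cell → List ℕ × List Cell
  | [] => ([], [])
  | p :: L => ((rowInsert p.2 (bumpCells L).1).1,
      (rowInsert p.2 (bumpCells L).1).2.toList.map (fun b => (p.1, b)) ++ (bumpCells L).2)

theorem bump_map_snd (L : List Cell) :
    bump [] (L.map Prod.snd) = ((bumpCells L).1, (bumpCells L).2.map Prod.snd) := by
  induction L with
  | nil => rfl
  | cons p L ih => simp [bump, bumpCells, ih, Function.comp_def]

theorem bumpCells_sublist (L : List Cell) :
    ((bumpCells L).2.map Prod.fst).Sublist (L.map Prod.fst) := by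
  induction L with
  | nil => exact .slnil
  | cons p L ih =>
    rcases rowInsert_cases p.2 (bumpCells L).1 with ⟨_, e⟩ | ⟨l, b, t, _, _, _, e⟩
    · simpa [bumpCells, e] using ih.cons p.1
    · simpa [bumpCells, e] using ih

theorem bumpCells_isStable {L : List Cell} (h₁ : L.Pairwise fun p q => p.1 < q.1)
    (h₂ : (L.map Prod.snd).Nodup) : IsStable {p | p ∈ L} {p | p ∈ (bumpCells L).2} := by
  have hperm := bump_perm [] (L.map Prod.snd)
  rw [bump_map_snd, List.append_nil] at hperm
  have hsnd : ((bumpCells L).2.map Prod.snd).Nodup := (hperm.nodup_iff.2 h₂).of_append_left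
  have hfst : ((bumpCells L).2.map Prod.fst).Nodup :=
    ((List.pairwise_map.2 h₁).imp fun h => ne_of_lt h).sublist (bumpCells_sublist L)
  refine ⟨?_, fun p hp q hq => List.inj_on_of_nodup_map hfst hp hq,
    fun p hp q hq => List.inj_on_of_nodup_map hsnd hp hq, ?_⟩
  all_goals clear hperm hsnd hfst
  · induction L with
    | nil => simp [bumpCells]
    | cons p L ih =>
      rw [List.pairwise_cons] at h₁
      rw [List.map_cons, List.nodup_cons] at h₂
      have ih' : ∀ q ∈ (bumpCells L).2, Admissible {q | q ∈ p :: L} q.1 q.2 := by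
        intro q hq
        obtain ⟨⟨x, hx, hx'⟩, y, hy, hy'⟩ := ih h₁.2 h₂.2 q hq
        exact ⟨⟨x, List.mem_cons_of_mem _ hx, hx'⟩, y, List.mem_cons_of_mem _ hy, hy'⟩
      rcases rowInsert_cases p.2 (bumpCells L).1 with ⟨_, e⟩ | ⟨l, b, t, hb, _, hpb, e⟩
      · simpa [bumpCells, e] using ih'
      · intro q hq
        simp only [bumpCells, e, Option.toList_some, List.map_cons, List.map_nil,
          List.singleton_append, List.mem_cons, Set.mem_ofPred_eq] at hq
        rcases hq with rfl | hq
        · have hperm := bump_perm [] (L.map Prod.snd)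
          rw [bump_map_snd, List.append_nil] at hperm
          have hbL : b ∈ L.map Prod.snd := hperm.subset (by simp [hb])
          obtain ⟨x, hx, rfl⟩ := List.mem_map.1 hbL
          exact ⟨⟨x, List.mem_cons_of_mem _ hx, rfl, h₁.1 x hx⟩, p, List.mem_cons_self, rfl, hpb⟩
        · exact ih' q hq
  · induction L with
    | nil =>
      rintro c r ⟨⟨x, hx, -⟩, -⟩
      simp at hx
    | cons p L ih =>
      rw [List.pairwise_cons] at h₁
      rw [List.map_cons, List.nodup_cons] at h₂
      have hmem : ∀ q ∈ (bumpCells L).2, q ∈ (bumpCells (p :: L)).2 := fun q hq => by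
        simp [bumpCells, hq]
      rintro c r ⟨⟨x, hx, rfl, hcx⟩, y, hy, rfl, hyx⟩
      simp only [Set.mem_ofPred_eq, List.mem_cons] at hx hy
      have hxL : x ∈ L := by
        rcases hx with rfl | hx
        · rcases hy with rfl | hy
          · omega
          · exact absurd (h₁.1 y hy) (by omega)
        · exact hx
      rcases hy with rfl | hy
      · have hperm := bump_perm [] (L.map Prod.snd)
        rw [bump_map_snd, List.append_nil] at hperm
        have hxC := hperm.symm.subset (List.mem_map_of_mem (f := Prod.snd) hxL)
        rw [List.mem_append, List.mem_map] at hxC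
        rcases hxC with ⟨q, hq, hqx⟩ | hxC
        · have hqL := (bumpCells_sublist L).subset (List.mem_map_of_mem (f := Prod.fst) hq)
          obtain ⟨z, hz, hzq⟩ := List.mem_map.1 hqL
          exact .inr ⟨q.1, hzq ▸ (h₁.1 z hz).le, hmem _ (hqx ▸ hq)⟩
        · rcases rowInsert_cases y.2 (bumpCells L).1 with ⟨h, _⟩ | ⟨l, b, t, hb, hl, _, e⟩
          · exact absurd (h _ hxC) (by omega)
          · refine .inl ⟨b, ?_, by simp [bumpCells, e]⟩
            have hC := bump_sorted (C := []) (u := L.map Prod.snd) .nil (by simpa using h₂.2)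
            rw [bump_map_snd, hb, List.pairwise_append, List.pairwise_cons] at hC
            rw [hb, List.mem_append, List.mem_cons] at hxC
            rcases hxC with h | h | h
            · exact absurd (hl _ h) (by omega)
            · exact h.ge
            · exact (hC.2.1.1 _ h).le
      · rcases ih h₁.2 h₂.2 y.1 x.2 ⟨⟨x, hxL, rfl, hcx⟩, y, hy, rfl, hyx⟩ with
          ⟨r', h, h'⟩ | ⟨c', h, h'⟩
        · exact .inl ⟨r', h, hmem _ h'⟩
        · exact .inr ⟨c', h, hmem _ h'⟩

theorem rsSteps_pairwise (P : Finset Cell) : (rsSteps P).Pairwise fun p q => p.1 < q.1 := by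
  rw [rsSteps, List.pairwise_map]
  exact (P.image Prod.fst).sortedLT_sort.pairwise

theorem mem_rsSteps {P : Finset Cell} (hP : ∀ p ∈ P, ∀ q ∈ P, p.1 = q.1 → p = q) {p : Cell} :
    p ∈ rsSteps P ↔ p ∈ P := by
  have hrow : ∀ q ∈ P, rowAt P q.1 = q.2 := by
    intro q hq
    have : {r | (q.1, r) ∈ P} = {q.2} := by
      ext r
      refine ⟨fun h => ?_, fun h => ?_⟩
      · exact congrArg Prod.snd (hP _ h q hq rfl)
      · rw [Set.mem_singleton_iff] at h
        simpa [h] using hq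
    rw [rowAt, this, csSup_singleton]
  simp only [rsSteps, List.mem_map, Finset.mem_sort, Finset.mem_image]
  constructor
  · rintro ⟨c, ⟨q, hq, rfl⟩, rfl⟩
    rw [hrow q hq]
    exact hq
  · exact fun hp => ⟨p.1, ⟨p, hp, rfl⟩, by rw [hrow p hp]⟩

theorem rsSteps_eq {P : Finset Cell} {L : List Cell} (hL : L.Pairwise fun p q => p.1 < q.1)
    (hP : ∀ p, p ∈ P ↔ p ∈ L) : rsSteps P = L := by
  have hinj : ∀ p ∈ P, ∀ q ∈ P, p.1 = q.1 → p = q := fun p hp q hq =>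
    List.inj_on_of_nodup_map ((List.pairwise_map.2 hL).imp fun h => ne_of_lt h)
      ((hP p).1 hp) ((hP q).1 hq)
  have hnodup : ∀ L' : List Cell, (L'.Pairwise fun p q => p.1 < q.1) → L'.Nodup := fun L' h =>
    h.imp fun hpq e => (e ▸ hpq).ne rfl
  refine List.Perm.eq_of_pairwise (le := fun p q : Cell => p.1 < q.1) ?_ (rsSteps_pairwise P) hL ?_
  · intro p q _ _ h h'
    omega
  · rw [List.perm_ext_iff_of_nodup (hnodup _ (rsSteps_pairwise P)) (hnodup _ hL)]
    exact fun p => (mem_rsSteps hinj).trans (hP p)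

theorem insTab_eq (P : Finset Cell) :
    insTab P = ((rsSteps P).map Prod.snd).reverse.foldr tabInsert [] := by
  have h : ∀ (L : List Cell) (T R : List (List ℕ)),
      (L.foldl (fun TR cv =>
        let T' := tabInsert cv.2 TR.1
        (T', placeAt cv.1 (diffRow TR.1 T') TR.2)) (T, R)).1 =
      (L.map Prod.snd).foldl (fun T v => tabInsert v T) T := by
    intro L
    induction L with
    | nil => exact fun _ _ => rfl
    | cons p L ih => exact fun T R => ih _ _
  rw [insTab, rsPair, h, List.foldr_reverse]

/-- **Theorem.** For a rook placement `P` on a rectangular Ferrers board,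
`ins(pivL(P)) = ⁻(ins(P))`, where `⁻Y` removes the left column of `Y`. -/
theorem ins_pivL (m n : ℕ) (P : Finset Cell) (hP : IsPlacement (Rect m n) P) :
    insTab (pivL n P) = removeLeftCol (insTab P) := by
  obtain ⟨hR, hfst, hsnd⟩ := hP
  have hrect : ∀ p ∈ P, p.1 ≤ m ∧ 1 ≤ p.2 ∧ p.2 ≤ n := fun p hp => by
    have := hR hp
    simp only [Rect, Finset.mem_product, Finset.mem_Icc] at this
    exact ⟨this.1.2, this.2⟩
  have hL := rsSteps_pairwise P
  have hnodup : ((rsSteps P).map Prod.snd).Nodup := by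
    refine List.Nodup.map_on (fun p hp q hq => ?_) (hL.imp fun hpq e => (e ▸ hpq).ne rfl)
    exact hsnd p ((mem_rsSteps hfst).1 hp) q ((mem_rsSteps hfst).1 hq)
  have hset : {p | p ∈ rsSteps P} = (P : Set Cell) := Set.ext fun p => mem_rsSteps hfst
  have hstable := bumpCells_isStable hL hnodup
  rw [hset] at hstable
  have hpiv := (pivL_isStable fun p hp => (hrect p hp).2).eq hstable (B := m)
    fun p hp => (hrect p hp).1
  have hsteps : rsSteps (pivL n P) = (bumpCells (rsSteps P)).2 := by
    refine rsSteps_eq ?_ fun p => Set.ext_iff.1 hpiv p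
    exact List.pairwise_map.1 ((List.pairwise_map.2 hL).sublist (bumpCells_sublist _))
  rw [insTab_eq, insTab_eq, hsteps, ← foldr_tabInsert_bump hnodup, bump_map_snd]
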